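/- arXiv:1406.1248 — 2 statements merged into one kernel-verified Lean document; each statement's English description precedes it below -/
import Mathlib

section
/- For all ε with 1 − e^{−1} ≤ ε ≤ 1, one has φ(−ε) ≤ 1 ≤ (1 + 5·√(1−ε))·φ(−ε). -/
noncomputable section

/-- `φ(x) = (1+x)·log(1+x) − x` (with `0·log 0 = 0`, so `φ(−1) = 1`). -/
def phi (x : ℝ) : ℝ := (1 + x) * Real.log (1 + x) - x

/-- **Lemma (Janson–Warnke, Lemma 2.8).** For all `1 − e^{−1} ≤ ε ≤ 1` we have
`φ(−ε) ≤ 1 ≤ (1 + 5√(1−ε)) φ(−ε)`. -/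
theorem stmt_9 (ε : ℝ) (hε0 : 1 - Real.exp (-1) ≤ ε) (hε1 : ε ≤ 1) :
    phi (-ε) ≤ 1 ∧ 1 ≤ (1 + 5 * Real.sqrt (1 - ε)) * phi (-ε) := by
  obtain ⟨t, rfl⟩ : ∃ t, ε = 1 - t := ⟨1 - ε, by ring⟩
  have ht0 : 0 ≤ t := by linarith
  have ht1 : t ≤ Real.exp (-1) := by linarith
  have he : Real.exp (-1) < 0.37 := by linarith [Real.exp_neg_one_lt_d9]
  have hphi : phi (-(1 - t)) = t * Real.log t + 1 - t := by
    unfold phi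
    rw [show 1 + -(1 - t) = t by ring]
    ring
  rw [hphi, show 1 - (1 - t) = t by ring]
  refine ⟨by nlinarith [Real.log_nonpos ht0 (by linarith)], ?_⟩
  rcases ht0.eq_or_lt with rfl | ht
  · simp
  obtain ⟨s, hs, rfl⟩ : ∃ s, 0 < s ∧ t = s ^ 2 :=
    ⟨√t, Real.sqrt_pos.2 ht, (Real.sq_sqrt ht0).symm⟩
  rw [Real.sqrt_sq hs.le, Real.log_pow]
  push_cast
  set c := Real.exp (-1 / 2) with hc
  have hc0 : 0 < c := Real.exp_pos _
  have hc2 : c ^ 2 = Real.exp (-1) := by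
    rw [hc, ← Real.exp_nat_mul]
    norm_num
  have hsc : s ≤ c := by
    rw [← hc2] at ht1
    exact (sq_le_sq₀ hs.le hc0.le).1 ht1
  have hc1 : c ≤ 0.61 := by nlinarith
  have hlog : -1 / 2 - Real.log s ≤ c / s - 1 := by
    have h := Real.log_le_sub_one_of_pos (div_pos hc0 hs)
    rwa [Real.log_div hc0.ne' hs.ne', hc, Real.log_exp] at h
  have hslog : s * (1 - 2 * Real.log s) ≤ 2 * c := by
    have h := mul_le_mul_of_nonneg_left hlog hs.le
    rw [mul_sub s (c / s), mul_div_cancel₀ _ hs.ne'] at h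
    linarith
  have hmain : (1 + 5 * s) * (s * (1 - 2 * Real.log s)) ≤ 5 :=
    calc (1 + 5 * s) * (s * (1 - 2 * Real.log s)) ≤ (1 + 5 * s) * (2 * c) := by gcongr
      _ ≤ (1 + 5 * c) * (2 * c) := by gcongr
      _ ≤ 5 := by nlinarith
  linarith [mul_le_mul_of_nonneg_left hmain hs.le]
end
end

section
/- Let ε ∈ [0,1] and A ∈ [0,∞), and set γ = A − 1. If A·ε ≤ 1 then φ(−A·ε) ≤ (1 + A·ε)·A²·φ(−ε). If 0 ≤ 3·√γ ≤ 1 − ε then φ(−A·ε) ≤ (1 + √γ)·φ(−ε). -/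
noncomputable section

theorem phi_neg_one : phi (-1) = 1 := by simp [phi]

/-- The truncated Taylor series bounds `-log (1 - x)` from below. -/
theorem add_sq_div_two_le_neg_log_one_sub {x : ℝ} (h0 : 0 ≤ x) (h1 : x < 1) :
    x + x ^ 2 / 2 ≤ -Real.log (1 - x) := by
  have hs := Real.hasSum_pow_div_log_of_abs_lt_one (x := x) (by rwa [abs_of_nonneg h0])
  have h := sum_le_hasSum (Finset.range 2) (fun n _ => by positivity) hs
  norm_num [Finset.sum_range_succ] at h
  linarith

theorem phi_neg_le {x : ℝ} (h0 : 0 ≤ x) (h1 : x ≤ 1) :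
    phi (-x) ≤ (1 + x) * (x ^ 2 / 2) := by
  rcases h1.eq_or_lt with rfl | h1
  · norm_num [phi_neg_one]
  · have h := mul_le_mul_of_nonneg_left (add_sq_div_two_le_neg_log_one_sub h0 h1)
      (sub_nonneg.2 h1.le)
    unfold phi
    rw [← sub_eq_add_neg]
    nlinarith

theorem sq_div_two_le_phi_neg {x : ℝ} (h0 : 0 ≤ x) (h1 : x ≤ 1) :
    x ^ 2 / 2 ≤ phi (-x) := by
  rcases h1.eq_or_lt with rfl | h1
  · norm_num [phi_neg_one]
  · have hu : 0 < 1 - x := by linarith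
    have h : Real.sinh (Real.log (1 - x)) ≤ Real.log (1 - x) :=
      Real.sinh_le_self_iff.2 (Real.log_nonpos hu.le (by linarith))
    rw [Real.sinh_log hu] at h
    have h2 := mul_le_mul_of_nonneg_left h hu.le
    have h3 : (1 - x) * (((1 - x) - (1 - x)⁻¹) / 2) = ((1 - x) ^ 2 - 1) / 2 := by
      field_simp
    unfold phi
    rw [← sub_eq_add_neg]
    nlinarith

/-- The graph of `x ↦ φ(-x)` lies above its tangent at `y`. -/
theorem phi_neg_tangent_le {x y : ℝ} (hx : x ≤ 1) (hy : y < 1) :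
    phi (-y) + (x - y) * -Real.log (1 - y) ≤ phi (-x) := by
  rcases hx.eq_or_lt with rfl | hx
  · rw [phi_neg_one, phi, ← sub_eq_add_neg]
    linarith
  · have hu : 0 < 1 - x := by linarith
    have hv : 0 < 1 - y := by linarith
    have h := Real.log_le_sub_one_of_pos (div_pos hv hu)
    rw [Real.log_div hv.ne' hu.ne'] at h
    have h2 := mul_le_mul_of_nonneg_left h hu.le
    have h3 : (1 - x) * ((1 - y) / (1 - x) - 1) = x - y := by
      field_simp
      ring
    unfold phi
    rw [← sub_eq_add_neg, ← sub_eq_add_neg]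
    nlinarith

theorem phi_neg_le_phi_neg {x y : ℝ} (h0 : 0 ≤ y) (hyx : y ≤ x) (hx : x ≤ 1) :
    phi (-y) ≤ phi (-x) := by
  rcases (hyx.trans hx).eq_or_lt with rfl | hy
  · rw [le_antisymm hx hyx]
  · have h := phi_neg_tangent_le hx hy
    have hl := Real.log_nonpos (sub_nonneg.2 hy.le) (by linarith)
    nlinarith [mul_nonneg (sub_nonneg.2 hyx) (neg_nonneg.2 hl)]

theorem phi_neg_one_add_sq_mul_le {x s : ℝ} (h0 : 0 ≤ x) (hs : 0 < s) (h : 3 * s ≤ 1 - x) :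
    phi (-((1 + s ^ 2) * x)) ≤ (1 + s) * phi (-x) := by
  have hs3 : s ≤ 1 / 3 := by linarith
  have hsx : s * x ≤ 1 / 3 := by nlinarith
  set y := (1 + s ^ 2) * x with hy
  have hv : s * (3 - s * x) ≤ 1 - y := by rw [hy]; nlinarith
  have hv0 : 0 < 1 - y := lt_of_lt_of_le (mul_pos hs (by linarith)) hv
  have ht := phi_neg_tangent_le (x := x) (y := y) (by linarith) (by linarith)
  have hl : -Real.log (1 - y) ≤ y / (1 - y) := by
    have := Real.one_sub_inv_le_log_of_pos hv0
    have h2 : y / (1 - y) = (1 - y)⁻¹ - 1 := by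
      field_simp
      ring
    linarith
  have hb : s * (y / (1 - y)) ≤ x / 2 := by
    rw [← mul_div_assoc, div_le_iff₀ hv0]
    have h1 : s * (1 + s ^ 2) ≤ s * (3 - s * x) / 2 := by nlinarith
    calc s * y = x * (s * (1 + s ^ 2)) := by rw [hy]; ring
      _ ≤ x * ((1 - y) / 2) := by gcongr; linarith
      _ = x / 2 * (1 - y) := by ring
  have hq := sq_div_two_le_phi_neg h0 (by linarith : x ≤ 1)
  calc phi (-y) ≤ phi (-x) + s * x * (s * -Real.log (1 - y)) := by
        have : x - y = -(s ^ 2 * x) := by rw [hy]; ring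
        rw [this] at ht
        linarith
    _ ≤ phi (-x) + s * x * (x / 2) := by
        gcongr
        exact (mul_le_mul_of_nonneg_left hl hs.le).trans hb
    _ = phi (-x) + s * (x ^ 2 / 2) := by ring
    _ ≤ phi (-x) + s * phi (-x) := by gcongr
    _ = (1 + s) * phi (-x) := by ring

/-- **Lemma (Janson–Warnke, Lemma 2.9).** For `ε ∈ [0,1]`, `A ∈ [0,∞)` and `γ = A − 1`:
if `Aε ≤ 1` then `φ(−Aε) ≤ (1+Aε)A²φ(−ε)`, and if `0 ≤ 3√γ ≤ 1−ε` then
`φ(−Aε) ≤ (1+√γ)φ(−ε)`. -/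
theorem stmt_10 (ε A γ : ℝ) (hε0 : 0 ≤ ε) (hε1 : ε ≤ 1) (hA : 0 ≤ A) (hγ : γ = A - 1) :
    (A * ε ≤ 1 → phi (-(A * ε)) ≤ (1 + A * ε) * A ^ 2 * phi (-ε)) ∧
    (0 ≤ 3 * Real.sqrt γ → 3 * Real.sqrt γ ≤ 1 - ε →
      phi (-(A * ε)) ≤ (1 + Real.sqrt γ) * phi (-ε)) := by
  refine ⟨fun h => ?_, fun _ h => ?_⟩
  · calc phi (-(A * ε)) ≤ (1 + A * ε) * ((A * ε) ^ 2 / 2) := phi_neg_le (by positivity) h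
      _ = (1 + A * ε) * A ^ 2 * (ε ^ 2 / 2) := by ring
      _ ≤ (1 + A * ε) * A ^ 2 * phi (-ε) := by
        gcongr
        exact sq_div_two_le_phi_neg hε0 hε1
  · rcases le_or_gt γ 0 with hγ0 | hγ0
    · rw [Real.sqrt_eq_zero_of_nonpos hγ0, add_zero, one_mul]
      exact phi_neg_le_phi_neg (by positivity) (mul_le_of_le_one_left hε0 (by linarith)) hε1
    · have hA' : A = 1 + Real.sqrt γ ^ 2 := by
        rw [Real.sq_sqrt hγ0.le]
        linarith
      have := phi_neg_one_add_sq_mul_le hε0 (Real.sqrt_pos.2 hγ0) h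
      rwa [← hA'] at this
end
end
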